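/- Fix κ > 0 and a probability measure G on ℝ with G((−∞,0]) = 0 and G((δ,∞)) > 0 for some δ > 0; for s ≥ 0 let μ_s := cp(κs, G). Fix η₁, η₂, q ∈ ℝ with c := ∫ e^{−η₂ y} dG(y) < ∞. For s > 0 and x, y ∈ ℝ define N(s,x,y) := e^{−η₁}·μ_s({z : z < q − x − y}) + e^{−η₂(x+y−q)}·∫ e^{−η₂ z}·1_{\{z ≥ q−x−y\}} dμ_s(z), and H(s,x,y) := N(s,x,y)/N(s,x,0) (the denominator is strictly positive). Then: (i) if x > q, then H(s,x,y) = e^{−η₂ y} for all s > 0 and all y ≥ 0; (ii) if x < q and y > 0, then lim_{s→0⁺} H(s,x,y) = 1 when y < q − x, and lim_{s→0⁺} H(s,x,y) = e^{η₁ − η₂(x+y−q)} when y ≥ q − x. -/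

import Mathlib

open MeasureTheory Real Filter Topology

/-- `n`-fold convolution power of a measure on `ℝ` (`G^⋆0 = δ₀`). -/
noncomputable def convPow (G : Measure ℝ) : ℕ → Measure ℝ
  | 0 => Measure.dirac 0
  | n + 1 => (convPow G n).conv G

/-- The compound Poisson distribution `cp(λ, G) = ∑ₙ e^{-λ} λⁿ/n! • G^⋆n`. -/
noncomputable def cp (lam : ℝ) (G : Measure ℝ) : Measure ℝ :=
  Measure.sum fun n => (ENNReal.ofReal (exp (-lam) * lam ^ n / n.factorial)) • convPow G n

instance isProbabilityMeasure_convPow (G : Measure ℝ) [IsProbabilityMeasure G] (n : ℕ) :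
    IsProbabilityMeasure (convPow G n) := by
  induction n with
  | zero => exact inferInstanceAs (IsProbabilityMeasure (Measure.dirac 0))
  | succ n ih => exact inferInstanceAs (IsProbabilityMeasure ((convPow G n).conv G))

theorem integrable_exp_mul_convPow (G : Measure ℝ) [IsProbabilityMeasure G] {a : ℝ}
    (ha : Integrable (fun y => exp (a * y)) G) (n : ℕ) :
    Integrable (fun y => exp (a * y)) (convPow G n) := by
  induction n with
  | zero => exact integrable_dirac (by simp)
  | succ n ih =>
    rw [convPow, integrable_conv_iff (by fun_prop)]
    simp only [mul_add, exp_add, norm_mul, norm_eq_abs, abs_exp, integral_const_mul]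
    exact ⟨ae_of_all _ fun x => ha.const_mul _, ih.mul_const _⟩

theorem integral_exp_mul_convPow (G : Measure ℝ) [IsProbabilityMeasure G] {a : ℝ}
    (ha : Integrable (fun y => exp (a * y)) G) (n : ℕ) :
    ∫ y, exp (a * y) ∂(convPow G n) = (∫ y, exp (a * y) ∂G) ^ n := by
  induction n with
  | zero => simp [convPow]
  | succ n ih =>
    have h := integrable_exp_mul_convPow G ha (n + 1)
    rw [convPow] at h ⊢
    rw [integral_conv h]
    simp only [mul_add, exp_add, integral_const_mul, integral_mul_const, ih, pow_succ]

theorem convPow_Iio_zero (G : Measure ℝ) [IsProbabilityMeasure G] (hG : G (Set.Iio 0) = 0)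
    (n : ℕ) : convPow G n (Set.Iio 0) = 0 := by
  induction n with
  | zero => simp [convPow]
  | succ n ih =>
    rw [convPow, Measure.conv, Measure.map_apply (by fun_prop) measurableSet_Iio]
    refine measure_mono_null (t := Set.Iio 0 ×ˢ Set.univ ∪ Set.univ ×ˢ Set.Iio 0) ?_ ?_
    · rintro ⟨u, v⟩ h
      simp only [Set.mem_preimage, Set.mem_Iio] at h
      simp only [Set.mem_union, Set.mem_prod, Set.mem_Iio, Set.mem_univ, and_true, true_and]
      by_contra! h'
      linarith
    · simp [Measure.prod_prod, ih, hG]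

theorem cp_Iio_zero (G : Measure ℝ) [IsProbabilityMeasure G] (hG : G (Set.Iio 0) = 0)
    (lam : ℝ) : cp lam G (Set.Iio 0) = 0 := by
  simp [cp, Measure.sum_apply _ measurableSet_Iio, convPow_Iio_zero G hG]

theorem cp_ne_zero (G : Measure ℝ) (lam : ℝ) : cp lam G ≠ 0 := by
  intro h
  rw [cp, Measure.sum_eq_zero] at h
  have h0 := congrArg (fun μ : Measure ℝ => μ Set.univ) (h 0)
  simp [convPow] at h0
  exact absurd h0 (not_le.2 (exp_pos _))

section ExpBound

variable {G : Measure ℝ} [IsProbabilityMeasure G] {a : ℝ} {f : ℝ → ℝ}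

theorem integrable_convPow_of_le_exp (ha : Integrable (fun y => exp (a * y)) G)
    (hf : Measurable f) (hfa : ∀ y, |f y| ≤ exp (a * y)) (n : ℕ) :
    Integrable f (convPow G n) :=
  (integrable_exp_mul_convPow G ha n).mono' hf.aestronglyMeasurable (ae_of_all _ hfa)

theorem integral_abs_convPow_le (ha : Integrable (fun y => exp (a * y)) G)
    (hf : Measurable f) (hfa : ∀ y, |f y| ≤ exp (a * y)) (n : ℕ) :
    ∫ y, |f y| ∂(convPow G n) ≤ (∫ y, exp (a * y) ∂G) ^ n := by
  rw [← integral_exp_mul_convPow G ha n]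
  exact integral_mono (integrable_convPow_of_le_exp ha hf hfa n).abs
    (integrable_exp_mul_convPow G ha n) hfa

theorem integrable_cp_of_le_exp (ha : Integrable (fun y => exp (a * y)) G)
    (hf : Measurable f) (hfa : ∀ y, |f y| ≤ exp (a * y)) {lam : ℝ} (hlam : 0 ≤ lam) :
    Integrable f (cp lam G) := by
  refine integrable_sum_measure
    (fun n => (integrable_convPow_of_le_exp ha hf hfa n).smul_measure ENNReal.ofReal_ne_top) ?_
  refine Summable.of_nonneg_of_le (fun n => by positivity) (fun n => ?_)
    ((summable_pow_div_factorial (lam * ∫ y, exp (a * y) ∂G)).mul_left (exp (-lam)))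
  rw [integral_smul_measure, ENNReal.toReal_ofReal (by positivity), smul_eq_mul]
  calc exp (-lam) * lam ^ n / n.factorial * ∫ y, ‖f y‖ ∂(convPow G n)
      ≤ exp (-lam) * lam ^ n / n.factorial * (∫ y, exp (a * y) ∂G) ^ n := by
        gcongr
        exact integral_abs_convPow_le ha hf hfa n
    _ = _ := by rw [mul_pow]; ring

theorem integral_cp_eq_tsum (ha : Integrable (fun y => exp (a * y)) G)
    (hf : Measurable f) (hfa : ∀ y, |f y| ≤ exp (a * y)) {lam : ℝ} (hlam : 0 ≤ lam) :
    ∫ y, f y ∂(cp lam G) =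
      ∑' n : ℕ, exp (-lam) * lam ^ n / n.factorial * ∫ y, f y ∂(convPow G n) := by
  have h := integrable_cp_of_le_exp ha hf hfa hlam
  rw [cp] at h ⊢
  rw [integral_sum_measure h]
  refine tsum_congr fun n => ?_
  rw [integral_smul_measure, ENNReal.toReal_ofReal (by positivity), smul_eq_mul]

/-- The compound Poisson distributions concentrate at `0` as the intensity tends to `0`. -/
theorem tendsto_integral_cp (ha : Integrable (fun y => exp (a * y)) G)
    (hf : Measurable f) (hfa : ∀ y, |f y| ≤ exp (a * y)) :
    Tendsto (fun lam => ∫ y, f y ∂(cp lam G)) (𝓝[>] 0) (𝓝 (f 0)) := by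
  have hsum : ∑' n : ℕ, exp (-0) * (0 : ℝ) ^ n / n.factorial * ∫ y, f y ∂(convPow G n) = f 0 := by
    rw [tsum_eq_single 0 fun n hn => by simp [hn]]
    simp [convPow]
  rw [← hsum]
  refine Tendsto.congr'
    (f₁ := fun lam => ∑' n : ℕ, exp (-lam) * lam ^ n / n.factorial * ∫ y, f y ∂(convPow G n))
    ?_ ?_
  · filter_upwards [self_mem_nhdsWithin] with lam hlam
    exact (integral_cp_eq_tsum ha hf hfa (le_of_lt hlam)).symm
  · refine tendsto_tsum_of_dominated_convergence
      (summable_pow_div_factorial (∫ y, exp (a * y) ∂G)) (fun n => ?_) ?_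
    · refine Tendsto.mono_left (Continuous.tendsto ?_ 0) nhdsWithin_le_nhds
      fun_prop
    · filter_upwards [Ioo_mem_nhdsGT (zero_lt_one' ℝ)] with lam hlam n
      have h0 : 0 ≤ lam := hlam.1.le
      have hw : exp (-lam) * lam ^ n ≤ 1 :=
        mul_le_one₀ (exp_le_one_iff.2 (by linarith)) (by positivity) (pow_le_one₀ h0 hlam.2.le)
      have hi : |∫ y, f y ∂(convPow G n)| ≤ (∫ y, exp (a * y) ∂G) ^ n :=
        abs_integral_le_integral_abs.trans (integral_abs_convPow_le ha hf hfa n)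
      rw [norm_mul, norm_eq_abs, norm_eq_abs,
        abs_of_nonneg (show 0 ≤ exp (-lam) * lam ^ n / n.factorial by positivity)]
      calc exp (-lam) * lam ^ n / n.factorial * |∫ y, f y ∂(convPow G n)|
          ≤ 1 / n.factorial * (∫ y, exp (a * y) ∂G) ^ n := by gcongr
        _ = _ := by ring

end ExpBound

/-- behaviour of the VaR-and-CVaR Girsanov kernel
`H(s,x,y) = N(s,x,y)/N(s,x,0)` with
`N(s,x,y) = e^{-η₁} μ_s(-∞, q-x-y) + e^{-η₂(x+y-q)} ∫ e^{-η₂ z} 1_{z ≥ q-x-y} dμ_s(z)`,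
`μ_s = cp(κs, G)`: it equals `e^{-η₂ y}` for `x > q`, and for `x < q`, `y > 0` its
limit as `s → 0⁺` is `1` if `y < q - x` and `e^{η₁ - η₂(x+y-q)}` if `y ≥ q - x`. -/
theorem stmt_13 (κ : ℝ) (hκ : 0 < κ) (G : Measure ℝ) [IsProbabilityMeasure G]
    (hG : G (Set.Iic 0) = 0) (δ : ℝ) (hδ : 0 < δ) (hGδ : 0 < G (Set.Ioi δ))
    (η₁ η₂ q : ℝ) (c : ℝ) (hc : c = ∫ y, exp (-η₂ * y) ∂G)
    (hcint : Integrable (fun y => exp (-η₂ * y)) G)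
    (N : ℝ → ℝ → ℝ → ℝ)
    (hN : N = fun s x y =>
      exp (-η₁) * ((cp (κ * s) G) {z | z < q - x - y}).toReal +
      exp (-η₂ * (x + y - q)) *
        ∫ z, exp (-η₂ * z) * (if q - x - y ≤ z then (1:ℝ) else 0) ∂(cp (κ * s) G))
    (H : ℝ → ℝ → ℝ → ℝ) (hH : H = fun s x y => N s x y / N s x 0) :
    (∀ x > q, ∀ s > (0:ℝ), ∀ y ≥ (0:ℝ), H s x y = exp (-η₂ * y)) ∧
    (∀ x < q, ∀ y > (0:ℝ),
      (y < q - x →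
        Filter.Tendsto (fun s => H s x y) (𝓝[>] (0:ℝ)) (𝓝 1)) ∧
      (q - x ≤ y →
        Filter.Tendsto (fun s => H s x y) (𝓝[>] (0:ℝ))
          (𝓝 (exp (η₁ - η₂ * (x + y - q)))))) := by
  have ha0 : Integrable (fun y => exp (0 * y)) G := by simp
  have hf1 (t : ℝ) : Measurable fun z : ℝ => exp (-η₂ * z) * (if t ≤ z then (1:ℝ) else 0) :=
    Measurable.mul (by fun_prop) (Measurable.ite measurableSet_Ici (by fun_prop) (by fun_prop))
  have hb1 (t z : ℝ) : |exp (-η₂ * z) * (if t ≤ z then (1:ℝ) else 0)| ≤ exp (-η₂ * z) := by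
    split_ifs <;> simp [exp_nonneg]
  have hscale : Tendsto (fun s : ℝ => κ * s) (𝓝[>] 0) (𝓝[>] 0) := by
    refine tendsto_nhdsWithin_iff.2 ⟨?_, ?_⟩
    · refine Tendsto.mono_left ?_ nhdsWithin_le_nhds
      simpa using (continuous_const_mul κ).tendsto 0
    · filter_upwards [self_mem_nhdsWithin] with s hs using mul_pos hκ hs
  have hmeas (t : ℝ) : Tendsto (fun s => ((cp (κ * s) G) {z | z < t}).toReal) (𝓝[>] 0)
      (𝓝 ((Set.Iio t).indicator 1 0)) := by
    have h := (tendsto_integral_cp ha0 (f := (Set.Iio t).indicator 1)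
      (measurable_one.indicator measurableSet_Iio) (fun y => by
        by_cases hy : y < t <;> simp [Set.indicator, hy])).comp hscale
    simp only [Function.comp_def, integral_indicator_one measurableSet_Iio] at h
    exact h
  have hN_lim (x y : ℝ) : Tendsto (fun s => N s x y) (𝓝[>] 0)
      (𝓝 (exp (-η₁) * (if 0 < q - x - y then 1 else 0) +
        exp (-η₂ * (x + y - q)) * (if q - x - y ≤ 0 then 1 else 0))) := by
    subst hN
    have hm := hmeas (q - x - y)
    simp only [Set.indicator_apply, Set.mem_Iio, Pi.one_apply] at hm
    refine (hm.const_mul _).add (Tendsto.const_mul _ ?_)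
    simpa [Function.comp_def] using
      (tendsto_integral_cp hcint (hf1 (q - x - y)) (hb1 (q - x - y))).comp hscale
  have hN0 (x : ℝ) (hx : x < q) : Tendsto (fun s => N s x 0) (𝓝[>] 0) (𝓝 (exp (-η₁))) := by
    have hp : 0 < q - x - 0 := by linarith
    simpa only [if_pos hp, if_neg hp.not_ge, mul_one, mul_zero, add_zero] using hN_lim x 0
  refine ⟨fun x hx s hs y hy => ?_, fun x hx y _ => ⟨fun hyx => ?_, fun hyx => ?_⟩⟩
  · have hnull := cp_Iio_zero G (measure_mono_null Set.Iio_subset_Iic_self hG) (κ * s)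
    have hN_eq (w : ℝ) (hw : 0 ≤ w) : N s x w =
        exp (-η₂ * (x + w - q)) * ∫ z, exp (-η₂ * z) ∂(cp (κ * s) G) := by
      have h1 : (cp (κ * s) G) {z | z < q - x - w} = 0 :=
        measure_mono_null (fun z (hz : z < q - x - w) => by
          rw [Set.mem_Iio]; linarith) hnull
      have h2 : ∫ z, exp (-η₂ * z) * (if q - x - w ≤ z then (1:ℝ) else 0) ∂(cp (κ * s) G) =
          ∫ z, exp (-η₂ * z) ∂(cp (κ * s) G) := by
        refine integral_congr_ae ?_
        filter_upwards [measure_eq_zero_iff_ae_notMem.1 hnull] with z hz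
        rw [Set.mem_Iio, not_lt] at hz
        rw [if_pos (by linarith), mul_one]
      rw [hN]
      simp only [h1, h2, ENNReal.toReal_zero, mul_zero, zero_add]
    have : NeZero (cp (κ * s) G) := ⟨cp_ne_zero G _⟩
    have hpos : 0 < ∫ z, exp (-η₂ * z) ∂(cp (κ * s) G) :=
      integral_exp_pos (integrable_cp_of_le_exp hcint (by fun_prop)
        (fun z => (abs_exp _).le) (mul_pos hκ hs).le)
    rw [hH]
    simp only [hN_eq y hy, hN_eq 0 le_rfl]
    rw [mul_div_mul_right _ _ hpos.ne', ← exp_sub]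
    ring_nf
  · have hp : 0 < q - x - y := by linarith
    have h := hN_lim x y
    simp only [if_pos hp, if_neg hp.not_ge, mul_one, mul_zero, add_zero] at h
    have h' := h.div (hN0 x hx) (exp_ne_zero _)
    rw [div_self (exp_ne_zero _)] at h'
    rw [hH]
    exact h'
  · have hp : q - x - y ≤ 0 := by linarith
    have h := hN_lim x y
    simp only [if_pos hp, if_neg hp.not_gt, mul_one, mul_zero, zero_add] at h
    have h' := h.div (hN0 x hx) (exp_ne_zero _)
    rw [← exp_sub, show -η₂ * (x + y - q) - -η₁ = η₁ - η₂ * (x + y - q) by ring] at h'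
    rw [hH]
    exact h'
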